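/- For every state-feedback policy μ : X → U and every initial state x₀ ∈ X, the liminf average cost satisfies J_(μ, x₀) ≥ min_{m ∈ S^k} g(m); that is, the optimal average cost of the stochastic k-server problem is bounded below by the optimal value of the k-median problem for (S, d, p). -/

import Mathlib

open Filter Finset

/-- Distribution of the chain after `t` steps under kernel `K`, started at `x₀`:
the `t`-fold monadic bind of `K` applied to the point mass at `x₀`. -/
noncomputable def chainDist {X : Type*} (K : X → PMF X) (x₀ : X) : ℕ → PMF X
  | 0 => PMF.pure x₀
  | t + 1 => (chainDist K x₀ t).bind K

/-- Expectation of `f` under a PMF on a finite type. -/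
noncomputable def pmfExp {X : Type*} [Fintype X] (q : PMF X) (f : X → ℝ) : ℝ :=
  ∑ x, (q x).toReal * f x

/-- The average cost over periods `0,…,T` of running the Markov chain with step
kernel `K` and per-stage cost `c`, started at `x₀`. -/
noncomputable def avgCost {X : Type*} [Fintype X] (K : X → PMF X) (c : X → ℝ)
    (x₀ : X) (T : ℕ) : ℝ :=
  (1 / (T + 1 : ℝ)) * ∑ t ∈ Finset.range (T + 1), pmfExp (chainDist K x₀ t) c

/-- Step kernel of the stochastic `k`-server problem under policy `μ`: the state is
`(x̂, x₁, …, x_k)`; server `μ x` relocates to the request location `x.1` and the next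
request is drawn from `p`. -/
noncomputable def kServerKernel {S : Type*} {k : ℕ} (p : PMF S)
    (μ : S × (Fin k → S) → Fin k) (x : S × (Fin k → S)) : PMF (S × (Fin k → S)) :=
  p.map (fun s => (s, Function.update x.2 (μ x) x.1))

/-- Per-stage cost of the stochastic `k`-server problem under policy `μ`:
the distance from the dispatched server to the request location. -/
noncomputable def kServerCost {S : Type*} [MetricSpace S] {k : ℕ}
    (μ : S × (Fin k → S) → Fin k) (x : S × (Fin k → S)) : ℝ :=
  dist (x.2 (μ x)) x.1

/-- The `k`-median objective `g(m) = Σ_s p(s) · min_i d(m_i, s)`. -/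
noncomputable def kMedian {S : Type*} [Fintype S] [MetricSpace S] {k : ℕ} [NeZero k]
    (p : PMF S) (m : Fin k → S) : ℝ :=
  ∑ s, (p s).toReal * Finset.univ.inf' Finset.univ_nonempty (fun i => dist (m i) s)

/-- Expectations under a PMF on a finite type compose along `PMF.bind`. -/
theorem pmfExp_bind {X Y : Type*} [Fintype X] [Fintype Y] (q : PMF X) (K : X → PMF Y)
    (f : Y → ℝ) : pmfExp (q.bind K) f = pmfExp q fun x => pmfExp (K x) f := by
  have h (y : Y) : (q.bind K y).toReal = ∑ x, (q x).toReal * (K x y).toReal := by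
    rw [PMF.bind_apply, tsum_fintype, ENNReal.toReal_sum]
    · simp only [ENNReal.toReal_mul]
    · exact fun x _ => ENNReal.mul_ne_top (q.apply_ne_top x) ((K x).apply_ne_top y)
  simp only [pmfExp, h, Finset.sum_mul, Finset.mul_sum]
  rw [Finset.sum_comm]
  simp only [mul_assoc]

theorem pmfExp_pure {X : Type*} [Fintype X] (x : X) (f : X → ℝ) :
    pmfExp (PMF.pure x) f = f x := by
  classical
  rw [pmfExp, Finset.sum_eq_single x]
  · simp
  · intro y _ hy
    simp [PMF.pure_apply, hy]
  · simp

theorem pmfExp_map {X Y : Type*} [Fintype X] [Fintype Y] (q : PMF X) (g : X → Y)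
    (f : Y → ℝ) : pmfExp (q.map g) f = pmfExp q fun x => f (g x) := by
  simp only [PMF.map, pmfExp_bind, Function.comp_apply, pmfExp_pure]

theorem pmfExp_mono {X : Type*} [Fintype X] (q : PMF X) {f g : X → ℝ} (h : ∀ x, f x ≤ g x) :
    pmfExp q f ≤ pmfExp q g :=
  Finset.sum_le_sum fun x _ => mul_le_mul_of_nonneg_left (h x) ENNReal.toReal_nonneg

theorem pmfExp_const {X : Type*} [Fintype X] (q : PMF X) (c : ℝ) :
    pmfExp q (fun _ => c) = c := by
  have h : ∑ x, (q x).toReal = 1 := by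
    rw [← ENNReal.toReal_sum fun x _ => q.apply_ne_top x,
      ← tsum_fintype (L := .unconditional X), q.tsum_coe,
      ENNReal.toReal_one]
  rw [pmfExp, ← Finset.sum_mul, h, one_mul]

/-- If the expected cost after one step is at least `M` from every state, then the liminf of the
average costs is at least `M`. -/
theorem le_liminf_avgCost {X : Type*} [Fintype X] (K : X → PMF X) (c : X → ℝ) (x₀ : X) {M : ℝ}
    (h : ∀ x, M ≤ pmfExp (K x) c) : M ≤ liminf (avgCost K c x₀) atTop := by
  have hstep (t : ℕ) : M ≤ pmfExp (chainDist K x₀ (t + 1)) c := by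
    rw [chainDist, pmfExp_bind, ← pmfExp_const (chainDist K x₀ t) M]
    exact pmfExp_mono _ h
  have hlower (T : ℕ) : M + (c x₀ - M) * (1 / ((T : ℝ) + 1)) ≤ avgCost K c x₀ T := by
    have hsum : T * M ≤ ∑ t ∈ Finset.range T, pmfExp (chainDist K x₀ (t + 1)) c := by
      simpa using Finset.card_nsmul_le_sum (Finset.range T) _ M fun t _ => hstep t
    have hT : (0 : ℝ) < T + 1 := by positivity
    rw [avgCost, Finset.sum_range_succ', chainDist, pmfExp_pure, one_div_mul_eq_div,
      le_div_iff₀ hT]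
    have : (M + (c x₀ - M) * (1 / ((T : ℝ) + 1))) * (T + 1) = T * M + c x₀ := by
      field_simp
      ring
    linarith
  obtain ⟨C, hC⟩ := (Set.finite_range c).bddAbove
  have hupper (T : ℕ) : avgCost K c x₀ T ≤ C := by
    have hT : (0 : ℝ) < T + 1 := by positivity
    have hsum : ∑ t ∈ Finset.range (T + 1), pmfExp (chainDist K x₀ t) c ≤ (T + 1) * C := by
      simpa using Finset.sum_le_card_nsmul (Finset.range (T + 1)) _ C fun t _ =>
        (pmfExp_mono (chainDist K x₀ t) fun x => hC ⟨x, rfl⟩).trans_eq (pmfExp_const _ C)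
    rw [avgCost, one_div_mul_eq_div, div_le_iff₀ hT]
    linarith
  have hlim : Tendsto (fun T : ℕ => M + (c x₀ - M) * (1 / ((T : ℝ) + 1))) atTop (nhds M) := by
    simpa using (tendsto_one_div_add_atTop_nhds_zero_nat (𝕜 := ℝ)).const_mul (c x₀ - M)
      |>.const_add M
  rw [← hlim.liminf_eq]
  exact liminf_le_liminf (Eventually.of_forall hlower) hlim.isBoundedUnder_ge
    (isBoundedUnder_of ⟨C, hupper⟩).isCoboundedUnder_ge

/-- The expected cost after one step is at least the `k`-median objective at the server positions
reached by that step. -/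
theorem kMedian_le_pmfExp_kServerKernel {S : Type*} [Fintype S] [MetricSpace S] {k : ℕ} [NeZero k]
    (p : PMF S) (μ : S × (Fin k → S) → Fin k) (x : S × (Fin k → S)) :
    kMedian p (Function.update x.2 (μ x) x.1) ≤ pmfExp (kServerKernel p μ x) (kServerCost μ) := by
  rw [kServerKernel, pmfExp_map]
  exact pmfExp_mono p fun s => Finset.inf'_le _ (Finset.mem_univ _)

/-- The optimal average cost of the stochastic `k`-server problem is bounded below by
the optimal value of the `k`-median problem. -/
theorem liminf_avg_cost_ge_kMedian_min
    {S : Type*} [Fintype S] [Nonempty S] [MetricSpace S] {k : ℕ} [NeZero k]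
    (p : PMF S) (μ : S × (Fin k → S) → Fin k) (x₀ : S × (Fin k → S)) :
    liminf (avgCost (kServerKernel p μ) (kServerCost μ) x₀) atTop ≥
      Finset.univ.inf' Finset.univ_nonempty (fun m : Fin k → S => kMedian p m) := by
  exact le_liminf_avgCost _ _ x₀ fun x =>
    (Finset.inf'_le _ (Finset.mem_univ _)).trans (kMedian_le_pmfExp_kServerKernel p μ x)
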